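/- arXiv:gr-qc/0004008 — 2 statements merged into one kernel-verified Lean document; each statement's English description precedes it below -/
import Mathlib

section
/- Let F be smooth on a punctured neighbourhood of y ∈ ℝ³ and assume that both F and its partial derivative ∂_iF admit singular expansions at y. Then the Hadamard parties finies at y satisfy (∂_iF)_y = 3 (nⁱ r^{−1} F)_y; equivalently, if (f_a) are the expansion coefficients of F, then (∂_iF)_y = (3/4π) ∫_{S²} nⁱ f₁(n) dΩ(n). -/
open MeasureTheory Filter Topology Real Asymptotics

noncomputable section

abbrev E3 : Type := EuclideanSpace ℝ (Fin 3)
abbrev S2 : Type := Metric.sphere (0 : E3) 1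

/-- The surface measure `dΩ` on the unit sphere `S²` (total mass `4π`). -/
def dOmega : Measure S2 := (volume : Measure E3).toSphere

/-- A function on the unit sphere is smooth iff it is the restriction of
a smooth function on `ℝ³`. -/
def SmoothSphereFn (f : S2 → ℝ) : Prop :=
  ∃ g : E3 → ℝ, ContDiff ℝ (⊤ : ℕ∞) g ∧ ∀ n : S2, g (n : E3) = f n

/-- `F` admits a power-like singular expansion at `y` with coefficients `c`:
the family of exponents (the `a`'s with `c a ≠ 0`) is bounded below, with only
finitely many exponents below any given bound, the coefficients are smooth
functions on the sphere, and for every `N`, `F(y + r n) = Σ_{a ≤ N} r^a (c a)(n)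
+ o(r^N)` as `r → 0⁺`, uniformly in `n ∈ S²`. -/
structure HasSingExpansion (y : E3) (F : E3 → ℝ) (c : ℝ → S2 → ℝ) : Prop where
  smooth_coeffs : ∀ a : ℝ, SmoothSphereFn (c a)
  bddBelow : ∃ a₀ : ℝ, ∀ a : ℝ, a < a₀ → c a = 0
  finite_exponents : ∀ N : ℝ, {a : ℝ | a ≤ N ∧ c a ≠ 0}.Finite
  expansion : ∀ N : ℕ, ∀ ε > 0, ∃ δ > 0, ∀ r : ℝ, 0 < r → r < δ → ∀ n : S2,
    |F (y + r • (n : E3)) - ∑ᶠ (a : ℝ) (_ : a ≤ (N : ℝ)), r ^ a * c a n| ≤ ε * r ^ (N : ℝ)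

/-- The exponents of the singular expansion are integers. -/
def IntegerExponents (c : ℝ → S2 → ℝ) : Prop :=
  ∀ a : ℝ, c a ≠ 0 → ∃ k : ℤ, a = (k : ℝ)

/-- The Hadamard partie finie at the singular point, `(F)_y = (1/4π) ∫_{S²} f₀ dΩ`,
expressed in terms of the expansion coefficients `c` of `F`. -/
def pfAt (c : ℝ → S2 → ℝ) : ℝ :=
  (4 * π)⁻¹ * ∫ n : S2, c 0 n ∂dOmega

/-- `F` is smooth on a punctured neighbourhood of `y`. -/
def SmoothNearPunctured (y : E3) (F : E3 → ℝ) : Prop :=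
  ∃ U ∈ 𝓝 y, ContDiffOn ℝ (⊤ : ℕ∞) F (U \ {y})

/-- The quantity whose limit as `s → 0⁺` defines the Hadamard partie finie
`Pf_{s₁,s₂} ∫ F d³x`: the integral over `ℝ³` minus two balls of radius `s`,
plus the divergent subtractions built from the expansion coefficients `c` at `y₁`
and `d` at `y₂`. -/
def pfApprox (y₁ y₂ : E3) (s₁ s₂ : ℝ) (F : E3 → ℝ) (c d : ℝ → S2 → ℝ) (s : ℝ) : ℝ :=
  (∫ x in (Metric.closedBall y₁ s ∪ Metric.closedBall y₂ s)ᶜ, F x)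
    + (∑ᶠ (a : ℝ) (_ : a < -3), s ^ (a + 3) / (a + 3) * ∫ n : S2, c a n ∂dOmega)
    + Real.log (s / s₁) * (∫ n : S2, c (-3) n ∂dOmega)
    + (∑ᶠ (b : ℝ) (_ : b < -3), s ^ (b + 3) / (b + 3) * ∫ n : S2, d b n ∂dOmega)
    + Real.log (s / s₂) * (∫ n : S2, d (-3) n ∂dOmega)

/-- `Pf_{s₁,s₂} ∫ F d³x` exists and equals `L`. -/
def HasPfIntegral (y₁ y₂ : E3) (s₁ s₂ : ℝ) (F : E3 → ℝ) (c d : ℝ → S2 → ℝ) (L : ℝ) : Prop :=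
  Tendsto (pfApprox y₁ y₂ s₁ s₂ F c d) (𝓝[>] (0 : ℝ)) (𝓝 L)

/-- Membership in the class `𝓕`: smooth outside `{y₁, y₂}` and admitting singular
expansions at `y₁` (coefficients `c`) and `y₂` (coefficients `d`). -/
structure MemF (y₁ y₂ : E3) (F : E3 → ℝ) (c d : ℝ → S2 → ℝ) : Prop where
  smooth : ContDiffOn ℝ (⊤ : ℕ∞) F ({y₁, y₂}ᶜ : Set E3)
  exp₁ : HasSingExpansion y₁ F c
  exp₂ : HasSingExpansion y₂ F d

/-- The partial derivative `∂_i F` (as a plain function, defined outside the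
singularities via `fderiv`). -/
def pder (i : Fin 3) (F : E3 → ℝ) (x : E3) : ℝ :=
  fderiv ℝ F x (EuclideanSpace.single i 1)


lemma aux_unique (u : ℝ → ℝ) (T : Finset ℝ) : (∀ a ∈ T, a ≤ 1) →
    ((fun s : ℝ => ∑ a ∈ T, s ^ a * u a) =o[𝓝[>] (0 : ℝ)] (fun s : ℝ => s)) →
    ∀ a ∈ T, u a = 0 := by
  induction T using Finset.induction_on_min with
  | empty => intro _ _ a ha; simp at ha
  | insert b T hb ih =>
    intro hT ho
    have hbT : b ∉ T := fun h => lt_irrefl _ (hb b h)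
    have hub : u b = 0 := by
      have hb1 : b ≤ 1 := hT b (Finset.mem_insert_self _ _)
      have h1 : Tendsto (fun s : ℝ => s ^ (-b) * ∑ a ∈ insert b T, s ^ a * u a)
          (𝓝[>] 0) (𝓝 0) := by
        have h2 : (fun s : ℝ => s ^ (-b) * ∑ a ∈ insert b T, s ^ a * u a)
            =o[𝓝[>] (0 : ℝ)] (fun s : ℝ => s ^ (-b) * s) :=
          (isBigO_refl _ _).mul_isLittleO ho
        have h3 : (fun s : ℝ => s ^ (-b) * s) =O[𝓝[>] (0 : ℝ)] (fun _ : ℝ => (1 : ℝ)) := by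
          refine IsBigO.of_bound 1 ?_
          filter_upwards [Ioo_mem_nhdsGT (zero_lt_one (α := ℝ))] with s hs
          have : s ^ (-b) * s = s ^ (1 - b) := by
            rw [show (1 - b) = -b + 1 by ring, Real.rpow_add hs.1, Real.rpow_one]
          rw [this, norm_one, mul_one, Real.norm_eq_abs, abs_of_nonneg (by have := hs.1; positivity)]
          exact Real.rpow_le_one hs.1.le hs.2.le (by linarith)
        exact (isLittleO_one_iff ℝ).1 (h2.trans_isBigO h3)
      have h2 : Tendsto (fun s : ℝ => u b + ∑ a ∈ T, s ^ (a - b) * u a)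
          (𝓝[>] 0) (𝓝 (u b + ∑ a ∈ T, 0 * u a)) := by
        refine tendsto_const_nhds.add (tendsto_finsetSum _ fun a ha => ?_)
        refine Tendsto.mul_const _ ?_
        have hab : 0 < a - b := sub_pos.2 (hb a ha)
        have := (Real.continuousAt_rpow_const 0 (a - b) (Or.inr hab.le)).tendsto
        rw [Real.zero_rpow hab.ne'] at this
        exact this.mono_left nhdsWithin_le_nhds
      have h3 : (fun s : ℝ => s ^ (-b) * ∑ a ∈ insert b T, s ^ a * u a) =ᶠ[𝓝[>] 0]
          (fun s : ℝ => u b + ∑ a ∈ T, s ^ (a - b) * u a) := by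
        filter_upwards [self_mem_nhdsWithin] with s hs
        have hs : 0 < s := hs
        rw [Finset.sum_insert hbT, mul_add, Finset.mul_sum, ← mul_assoc, ← Real.rpow_add hs]
        simp only [neg_add_cancel, Real.rpow_zero, one_mul]
        congr 1
        refine Finset.sum_congr rfl fun a _ => ?_
        rw [← mul_assoc, ← Real.rpow_add hs]
        congr 2; ring
      have := tendsto_nhds_unique (h1.congr' h3) h2
      simpa using this.symm
    intro a ha
    rcases Finset.mem_insert.1 ha with rfl | ha
    · exact hub
    · refine ih (fun a ha => hT a (Finset.mem_insert_of_mem ha)) ?_ a ha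
      simpa [Finset.sum_insert hbT, hub] using ho

lemma aux_finsum (c : ℝ → S2 → ℝ) (N : ℝ) (T : Finset ℝ) (hT : ∀ a ∈ T, a ≤ N)
    (hT' : ∀ a, a ≤ N → c a ≠ 0 → a ∈ T) (r : ℝ) (n : S2) :
    ∑ᶠ (a : ℝ) (_ : a ≤ N), r ^ a * c a n = ∑ a ∈ T, r ^ a * c a n := by
  have h : ∀ a : ℝ, (∑ᶠ (_ : a ≤ N), r ^ a * c a n) = if a ≤ N then r ^ a * c a n else 0 := by
    intro a
    by_cases ha : a ≤ N <;> simp [ha]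
  simp_rw [h]
  rw [finsum_eq_sum_of_support_subset (s := T)]
  · refine Finset.sum_congr rfl fun a ha => ?_
    simp [hT a ha]
  · intro a ha
    simp only [Function.mem_support] at ha
    by_cases haN : a ≤ N
    · refine hT' a haN ?_
      rintro h0
      simp [h0] at ha
    · simp [haN] at ha

lemma aux_polar (w : ℝ → ℝ) (g : E3 → ℝ) :
    ∫ z : E3, w ‖z‖ * g (‖z‖⁻¹ • z) =
      (∫ t in Set.Ioi (0 : ℝ), t ^ 2 * w t) * ∫ n : S2, g n ∂dOmega := by
  have hd : Module.finrank ℝ E3 - 1 = 2 := by simp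
  calc
    ∫ z : E3, w ‖z‖ * g (‖z‖⁻¹ • z)
      = ∫ x : ({(0)}ᶜ : Set E3), w ‖x.1‖ * g (‖x.1‖⁻¹ • x.1) ∂((volume : Measure E3).comap (↑)) := by
      rw [integral_subtype_comap (measurableSet_singleton _).compl
        fun x : E3 ↦ w ‖x‖ * g (‖x‖⁻¹ • x), restrict_compl_singleton]
    _ = ∫ x : S2 × Set.Ioi (0 : ℝ), g x.1 * w x.2
          ∂(volume : Measure E3).toSphere.prod (.volumeIoiPow (Module.finrank ℝ E3 - 1)) := by
      have := (volume : Measure E3).measurePreserving_homeomorphUnitSphereProd.integral_comp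
        (Homeomorph.measurableEmbedding _)
        (fun x : S2 × Set.Ioi (0 : ℝ) => g x.1 * w x.2)
      rw [← this]
      refine integral_congr_ae (Eventually.of_forall fun x => ?_)
      simp [mul_comm]
    _ = (∫ n : S2, g n ∂dOmega) * ∫ t : Set.Ioi (0 : ℝ), w t ∂(Measure.volumeIoiPow 2) := by
      rw [hd]
      exact integral_prod_mul (fun n : S2 => g n) (fun t : Set.Ioi (0 : ℝ) => w t)
    _ = _ := by
      rw [mul_comm]
      congr 1
      simp only [Measure.volumeIoiPow, ENNReal.ofReal]
      rw [integral_withDensity_eq_integral_smul,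
        integral_subtype_comap measurableSet_Ioi fun a ↦ Real.toNNReal (a ^ 2) • w a,
        setIntegral_congr_fun measurableSet_Ioi fun x hx ↦ ?_]
      · rw [NNReal.smul_def, Real.coe_toNNReal _ (pow_nonneg hx.out.le _), smul_eq_mul]
      · exact (measurable_subtype_coe.pow_const _).real_toNNReal

/-- closed annulus -/
def Ann : Set E3 := {z | 1 ≤ ‖z‖ ∧ ‖z‖ ≤ 2}

lemma isClosed_Ann : IsClosed Ann :=
  (isClosed_le continuous_const continuous_norm).inter (isClosed_le continuous_norm continuous_const)

lemma isCompact_Ann : IsCompact Ann := by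
  refine (isCompact_closedBall (0 : E3) 2).of_isClosed_subset isClosed_Ann ?_
  intro z hz
  simpa using hz.2

lemma aux_integrable {h K : E3 → ℝ} (hh : ContinuousOn h Ann) (hK : Continuous K)
    (hK0 : ∀ z, z ∉ Ann → K z = 0) : Integrable (fun z => h z * K z) := by
  rw [← integrableOn_iff_integrable_of_support_subset (s := Ann)]
  · exact (hh.mul hK.continuousOn).integrableOn_compact isCompact_Ann
  · intro z hz
    by_contra hz'
    simp [hK0 z hz'] at hz

lemma aux_asymp {y : E3} {F : E3 → ℝ} {c : ℝ → S2 → ℝ} (hFc : HasSingExpansion y F c)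
    {g : ℝ → E3 → ℝ} (hg : ∀ a, Continuous (g a)) (hgc : ∀ a (n : S2), g a n = c a n)
    (N : ℕ) (T : Finset ℝ) (hT : ∀ a ∈ T, a ≤ (N : ℝ))
    (hT' : ∀ a : ℝ, a ≤ (N : ℝ) → c a ≠ 0 → a ∈ T)
    (hcont : ∀ᶠ s in 𝓝[>] (0 : ℝ), ContinuousOn (fun z : E3 => F (y + s • z)) Ann)
    {K : E3 → ℝ} (hK : Continuous K) (hK0 : ∀ z, z ∉ Ann → K z = 0) :
    (fun s : ℝ => (∫ z, F (y + s • z) * K z)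
        - ∑ a ∈ T, s ^ a * ∫ z, (‖z‖ ^ a * g a (‖z‖⁻¹ • z)) * K z)
      =o[𝓝[>] (0 : ℝ)] (fun s : ℝ => s ^ N) := by
  have hgi : ∀ a, ContinuousOn (fun z : E3 => ‖z‖ ^ a * g a (‖z‖⁻¹ • z)) Ann := by
    intro a
    have hne : ∀ z ∈ Ann, ‖z‖ ≠ 0 := fun z hz => by have := hz.1; linarith
    refine ContinuousOn.mul ?_ ?_
    · exact continuous_norm.continuousOn.rpow_const fun z hz => Or.inl (hne z hz)
    · exact (hg a).comp_continuousOn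
        ((continuous_norm.continuousOn.inv₀ hne).smul continuousOn_id)
  have hKi : Integrable K := by
    simpa using aux_integrable (h := fun _ => 1) continuousOn_const hK hK0
  rw [isLittleO_iff]
  intro ε hε
  set C : ℝ := 2 ^ N * ((∫ z, |K z|) + 1) with hC
  have hI : 0 ≤ ∫ z, |K z| := integral_nonneg fun z => abs_nonneg _
  have hCpos : 0 < C := by positivity
  obtain ⟨δ, hδ, hexp⟩ := hFc.expansion N (ε / C) (by positivity)
  filter_upwards [hcont, Ioo_mem_nhdsGT (show (0 : ℝ) < δ / 2 by positivity)] with s hsc hs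
  have hs0 := hs.1
  have hptw : ∀ z ∈ Ann, |F (y + s • z) - ∑ a ∈ T, s ^ a * (‖z‖ ^ a * g a (‖z‖⁻¹ • z))|
      ≤ ε / C * (s ^ N * 2 ^ N) := by
    intro z hz
    have hz0 : 0 < ‖z‖ := by have := hz.1; linarith
    have hn : ‖z‖⁻¹ • z ∈ Metric.sphere (0 : E3) 1 := by
      simp [norm_smul, hz0.ne']
    have h1 := hexp (s * ‖z‖) (by positivity) (by nlinarith [hz.2, hs.2]) ⟨_, hn⟩
    rw [aux_finsum c N T hT hT'] at h1
    have h2 : (s * ‖z‖) • (‖z‖⁻¹ • z) = s • z := by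
      rw [smul_smul, mul_assoc, mul_inv_cancel₀ hz0.ne', mul_one]
    simp only [h2, Real.rpow_natCast] at h1
    have h3 : ∀ a, (s * ‖z‖) ^ a * c a ⟨_, hn⟩ = s ^ a * (‖z‖ ^ a * g a (‖z‖⁻¹ • z)) := by
      intro a
      rw [Real.mul_rpow hs0.le hz0.le, ← hgc, mul_assoc]
    simp only [h3] at h1
    refine h1.trans ?_
    rw [mul_pow]
    have := hz.2
    gcongr
  have hsum : (∫ z, F (y + s • z) * K z)
        - ∑ a ∈ T, s ^ a * ∫ z, (‖z‖ ^ a * g a (‖z‖⁻¹ • z)) * K z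
      = ∫ z, (F (y + s • z) - ∑ a ∈ T, s ^ a * (‖z‖ ^ a * g a (‖z‖⁻¹ • z))) * K z := by
    have hexpand : ∀ z : E3,
        (F (y + s • z) - ∑ a ∈ T, s ^ a * (‖z‖ ^ a * g a (‖z‖⁻¹ • z))) * K z
        = F (y + s • z) * K z - ∑ a ∈ T, s ^ a * ((‖z‖ ^ a * g a (‖z‖⁻¹ • z)) * K z) := by
      intro z
      rw [sub_mul, Finset.sum_mul]
      congr 1
      exact Finset.sum_congr rfl fun a _ => by ring
    simp_rw [hexpand]
    rw [integral_sub (aux_integrable hsc hK hK0), integral_finsetSum]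
    · simp_rw [integral_const_mul]
    · intro a _
      exact (aux_integrable (hgi a) hK hK0).const_mul _
    · exact integrable_finsetSum _ fun a _ => (aux_integrable (hgi a) hK hK0).const_mul _
  rw [hsum]
  calc _ ≤ ∫ z, ε / C * (s ^ N * 2 ^ N) * |K z| := by
        refine norm_integral_le_of_norm_le (hKi.abs.const_mul _) (Eventually.of_forall fun z => ?_)
        rw [norm_mul, Real.norm_eq_abs, Real.norm_eq_abs]
        by_cases hz : z ∈ Ann
        · exact mul_le_mul_of_nonneg_right (hptw z hz) (abs_nonneg _)
        · simp [hK0 z hz]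
    _ = ε / C * (2 ^ N * ∫ z, |K z|) * s ^ N := by
        rw [integral_const_mul]; ring
    _ ≤ ε / C * C * s ^ N := by
        rw [hC]; gcongr; linarith
    _ = ε * ‖s ^ N‖ := by
        rw [div_mul_cancel₀ _ hCpos.ne', Real.norm_eq_abs, abs_of_pos (by positivity)]


lemma aux_oned {ψ : ℝ → ℝ} (hψ : ContDiff ℝ (⊤ : ℕ∞) ψ) (h0 : ∀ t, 4 < t → ψ t = 0) :
    ∫ t in Set.Ioi (0 : ℝ), t ^ 2 * (t ^ (1 : ℝ) * (2 * t * deriv ψ (t ^ 2)))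
      = -3 * ∫ t in Set.Ioi (0 : ℝ), t ^ 2 * (t ^ (0 : ℝ) * ψ (t ^ 2)) := by
  have h0' : ∀ t : ℝ, t ∉ Set.Icc (-2 : ℝ) 2 → ψ (t ^ 2) = 0 := by
    intro t ht
    refine h0 _ ?_
    by_contra h
    exact ht (abs_le.1 (abs_le_of_sq_le_sq (by linarith) (by norm_num)))
  have hd0 : ∀ t : ℝ, t ∉ Set.Icc (-2 : ℝ) 2 → deriv ψ (t ^ 2) = 0 := by
    intro t ht
    have h4 : 4 < t ^ 2 := by
      by_contra h
      exact ht (abs_le.1 (abs_le_of_sq_le_sq (by linarith) (by norm_num)))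
    have : ψ =ᶠ[𝓝 (t ^ 2)] fun _ => 0 := by
      filter_upwards [Ioi_mem_nhds h4] with x hx using h0 x hx
    rw [this.deriv_eq]; simp
  have hdc : Continuous (deriv ψ) := hψ.continuous_deriv (by simp)
  have hc := hψ.continuous
  have hdiff : ∀ t : ℝ, HasDerivAt (fun t : ℝ => t ^ 3 * ψ (t ^ 2))
      (3 * (t ^ 2 * ψ (t ^ 2)) + t ^ 3 * (2 * t * deriv ψ (t ^ 2))) t := by
    intro t
    have h1 : HasDerivAt ψ (deriv ψ (t ^ 2)) (t ^ 2) :=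
      (hψ.differentiable (by simp) _).hasDerivAt
    have h2 : HasDerivAt (fun t : ℝ => t ^ 2) (2 * t) t := by
      simpa using hasDerivAt_pow 2 t
    have h3 : HasDerivAt (fun t : ℝ => t ^ 3) (3 * t ^ 2) t := by
      simpa using hasDerivAt_pow 3 t
    have h4 : HasDerivAt (fun t : ℝ => ψ (t ^ 2)) (deriv ψ (t ^ 2) * (2 * t)) t :=
      HasDerivAt.comp (h := fun t : ℝ => t ^ 2) t h1 h2
    have h5 : HasDerivAt (fun t : ℝ => t ^ 3 * ψ (t ^ 2)) _ t := h3.mul h4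
    refine h5.congr_deriv ?_
    ring
  have hcs : HasCompactSupport (fun t : ℝ => t ^ 3 * ψ (t ^ 2)) :=
    HasCompactSupport.intro (isCompact_Icc (a := (-2 : ℝ)) (b := 2)) fun t ht => by simp [h0' t ht]
  have hcs1 : HasCompactSupport (fun t : ℝ => 3 * (t ^ 2 * ψ (t ^ 2))) :=
    HasCompactSupport.intro (isCompact_Icc (a := (-2 : ℝ)) (b := 2)) fun t ht => by simp [h0' t ht]
  have hcs2 : HasCompactSupport (fun t : ℝ => t ^ 3 * (2 * t * deriv ψ (t ^ 2))) :=
    HasCompactSupport.intro (isCompact_Icc (a := (-2 : ℝ)) (b := 2)) fun t ht => by simp [hd0 t ht]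
  have hC1 : ContDiff ℝ 1 (fun t : ℝ => t ^ 3 * ψ (t ^ 2)) := by
    have : ContDiff ℝ 1 ψ := hψ.of_le (by simp)
    fun_prop
  have key := hcs.integral_Ioi_deriv_eq hC1 0
  have hde : deriv (fun t : ℝ => t ^ 3 * ψ (t ^ 2)) = fun t =>
      3 * (t ^ 2 * ψ (t ^ 2)) + t ^ 3 * (2 * t * deriv ψ (t ^ 2)) := funext fun t => (hdiff t).deriv
  rw [hde, integral_add, integral_const_mul] at key
  · simp only [Real.rpow_one, Real.rpow_zero, one_mul]
    have : ∀ t : ℝ, t ^ 2 * (t * (2 * t * deriv ψ (t ^ 2))) = t ^ 3 * (2 * t * deriv ψ (t ^ 2)) :=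
      fun t => by ring
    simp only [this]
    norm_num at key
    linarith
  · exact ((by fun_prop : Continuous _).integrable_of_hasCompactSupport hcs1).integrableOn
  · exact ((by fun_prop : Continuous _).integrable_of_hasCompactSupport hcs2).integrableOn

lemma aux_main
    (y : E3) (F : E3 → ℝ) (c : ℝ → S2 → ℝ)
    (hF : SmoothNearPunctured y F) (hFc : HasSingExpansion y F c)
    (i : Fin 3) (c' : ℝ → S2 → ℝ)
    (hc' : HasSingExpansion y (pder i F) c') :
    ∫ n : S2, c' 0 n ∂dOmega = 3 * ∫ n : S2, (n : E3) i * c 1 n ∂dOmega := by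
  choose g hg hgc using hFc.smooth_coeffs
  choose g' hg' hgc' using hc'.smooth_coeffs
  obtain ⟨U, hU, hFU⟩ := hF
  obtain ⟨R, hR, hRU⟩ := Metric.mem_nhds_iff.1 hU
  have hopen : IsOpen (Metric.ball y R \ {y}) := Metric.isOpen_ball.sdiff isClosed_singleton
  have hFat : ∀ x ∈ Metric.ball y R \ {y}, ContDiffAt ℝ (⊤ : ℕ∞) F x := fun x hx =>
    (hFU.mono (Set.sdiff_subset_sdiff_left hRU)).contDiffAt (hopen.mem_nhds hx)
  have hmem : ∀ s ∈ Set.Ioo (0 : ℝ) (R / 2), ∀ z ∈ Ann, y + s • z ∈ Metric.ball y R \ {y} := by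
    intro s hs z hz
    have hz0 : 0 < ‖z‖ := by have := hz.1; linarith
    refine ⟨?_, ?_⟩
    · rw [Metric.mem_ball, dist_eq_norm, add_sub_cancel_left, norm_smul, Real.norm_eq_abs,
        abs_of_pos hs.1]
      nlinarith [hz.2, hs.1, hs.2]
    · simp [hs.1.ne', norm_pos_iff.1 hz0]
  have hev : ∀ᶠ s in 𝓝[>] (0 : ℝ), s ∈ Set.Ioo (0 : ℝ) (R / 2) :=
    Ioo_mem_nhdsGT (by positivity)
  have hcF : ∀ s ∈ Set.Ioo (0 : ℝ) (R / 2), ContinuousOn (fun z : E3 => F (y + s • z)) Ann := by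
    intro s hs z hz
    have h1 := (hFat _ (hmem s hs z hz)).continuousAt
    exact (ContinuousAt.comp (f := fun z : E3 => y + s • z) h1 (by fun_prop)).continuousWithinAt
  have hcP : ∀ s ∈ Set.Ioo (0 : ℝ) (R / 2),
      ContinuousOn (fun z : E3 => pder i F (y + s • z)) Ann := by
    intro s hs z hz
    have h1 : ContinuousAt (fderiv ℝ F) (y + s • z) :=
      ((hFat _ (hmem s hs z hz)).fderiv_right (m := 0) (by simp)).continuousAt
    have h2 : ContinuousAt (pder i F) (y + s • z) := h1.clm_apply continuousAt_const
    exact (ContinuousAt.comp (f := fun z : E3 => y + s • z) h2 (by fun_prop)).continuousWithinAt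
  -- the test function
  let ψ : ContDiffBump (5 / 2 : ℝ) := ⟨1 / 2, 3 / 2, by norm_num, by norm_num⟩
  have hψ : ContDiff ℝ (⊤ : ℕ∞) ψ := ψ.contDiff
  have hψ0 : ∀ t, t ∉ Set.Icc (1 : ℝ) 4 → ψ t = 0 := by
    intro t ht
    refine ψ.zero_of_le_dist ?_
    change (3 / 2 : ℝ) ≤ _
    rw [Real.dist_eq]
    by_contra h
    have := abs_lt.1 (not_le.1 h)
    exact ht ⟨by linarith [this.1], by linarith [this.2]⟩
  let Φ : E3 → ℝ := fun z => ψ (‖z‖ ^ 2)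
  have hΦ : ContDiff ℝ (⊤ : ℕ∞) Φ := hψ.comp (contDiff_norm_sq ℝ)
  have hΦ0 : ∀ z, z ∉ Ann → Φ z = 0 := by
    intro z hz
    refine hψ0 _ fun h => hz ⟨?_, ?_⟩
    · nlinarith [h.1, norm_nonneg z]
    · nlinarith [h.2, norm_nonneg z]
  have hΦs : tsupport Φ ⊆ Ann := by
    refine closure_minimal (fun z hz => ?_) isClosed_Ann
    by_contra h
    exact hz (hΦ0 z h)
  let K : E3 → ℝ := fun z => fderiv ℝ Φ z (EuclideanSpace.single i 1)
  have hKc : Continuous K := (hΦ.continuous_fderiv (by simp)).clm_apply continuous_const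
  have hK0 : ∀ z, z ∉ Ann → K z = 0 := by
    intro z hz
    have : Φ =ᶠ[𝓝 z] fun _ => 0 := by
      filter_upwards [isClosed_Ann.isOpen_compl.mem_nhds hz] with x hx using hΦ0 x hx
    simp only [K]
    rw [this.fderiv_eq]; simp
  have hKe : ∀ z, K z = 2 * z i * deriv ψ (‖z‖ ^ 2) := by
    intro z
    have h1 : HasDerivAt ψ (deriv ψ (‖z‖ ^ 2)) (‖z‖ ^ 2) :=
      (hψ.differentiable (by simp) _).hasDerivAt
    have h2 := h1.comp_hasFDerivAt z (hasStrictFDerivAt_norm_sq z).hasFDerivAt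
    have h3 : fderiv ℝ Φ z = _ := h2.fderiv
    simp only [K]
    rw [h3]
    simp [EuclideanSpace.inner_single_right]
    ring
  -- integration by parts
  have hibp : ∀ s ∈ Set.Ioo (0 : ℝ) (R / 2), ∫ z, F (y + s • z) * K z
      = - (s * ∫ z, pder i F (y + s • z) * Φ z) := by
    intro s hs
    have hdf : ∀ z ∈ Ann, HasFDerivAt (fun z : E3 => F (y + s • z))
        ((fderiv ℝ F (y + s • z)).comp (s • ContinuousLinearMap.id ℝ E3)) z := by
      intro z hz
      have h1 : HasFDerivAt F (fderiv ℝ F (y + s • z)) (y + s • z) :=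
        ((hFat _ (hmem s hs z hz)).differentiableAt (by simp)).hasFDerivAt
      have h2 : HasFDerivAt (fun z : E3 => y + s • z) (s • ContinuousLinearMap.id ℝ E3) z :=
        ((hasFDerivAt_id z).const_smul s).const_add y
      exact h1.comp z h2
    have he : (fun z => fderiv ℝ (fun z : E3 => F (y + s • z)) z (EuclideanSpace.single i 1) * Φ z)
        = fun z => s * (pder i F (y + s • z) * Φ z) := by
      funext z
      by_cases hz : z ∈ Ann
      · rw [(hdf z hz).fderiv]
        simp [pder, mul_assoc]
      · simp [hΦ0 z hz]
    have := integral_mul_fderiv_eq_neg_fderiv_mul_of_integrable (μ := (volume : Measure E3))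
      (f := fun z : E3 => F (y + s • z)) (g := Φ) (v := EuclideanSpace.single i 1)
      (by rw [he]; exact (aux_integrable (hcP s hs) hΦ.continuous hΦ0).const_mul _)
      (aux_integrable (hcF s hs) hKc hK0)
      (aux_integrable (hcF s hs) hΦ.continuous hΦ0)
      (fun z hz => (hdf z (hΦs hz)).differentiableAt)
      (fun z _ => hΦ.differentiable (by simp) z)
    rw [he, integral_const_mul] at this
    exact this
  -- the finite set of exponents
  let T : Finset ℝ := (hFc.finite_exponents 1).toFinset ∪
    ((hc'.finite_exponents 0).toFinset.image (fun a => a + 1) ∪ {1})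
  have hT1 : ∀ a ∈ T, a ≤ 1 := by
    intro a ha
    simp only [T, Finset.mem_union, Finset.mem_image, Set.Finite.mem_toFinset, Set.mem_ofPred_eq,
      Finset.mem_singleton] at ha
    rcases ha with h | ⟨b, hb, rfl⟩ | h
    · exact h.1
    · linarith [hb.1]
    · exact h.le
  let T' : Finset ℝ := T.image (fun a => a - 1)
  have hA := aux_asymp hFc (fun a => (hg a).continuous) hgc 1 T (by simpa using hT1)
    (by
      intro a ha hca
      simp only [T, Finset.mem_union, Set.Finite.mem_toFinset, Set.mem_ofPred_eq]
      exact Or.inl ⟨by simpa using ha, hca⟩)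
    (hev.mono hcF) hKc hK0
  have hB := aux_asymp hc' (fun a => (hg' a).continuous) hgc' 0 T'
    (by
      intro a ha
      obtain ⟨b, hb, rfl⟩ := Finset.mem_image.1 ha
      have := hT1 b hb
      push_cast; linarith)
    (by
      intro a ha hca
      refine Finset.mem_image.2 ⟨a + 1, ?_, by ring⟩
      simp only [T, Finset.mem_union]
      refine Or.inr (Or.inl (Finset.mem_image.2 ⟨a, ?_, rfl⟩))
      rw [Set.Finite.mem_toFinset]
      exact ⟨by simpa using ha, hca⟩)
    (hev.mono hcP) hΦ.continuous hΦ0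
  set Q : ℝ → ℝ := fun a => ∫ z, (‖z‖ ^ a * g a (‖z‖⁻¹ • z)) * K z with hQ
  set P : ℝ → ℝ := fun a => ∫ z, (‖z‖ ^ a * g' a (‖z‖⁻¹ • z)) * Φ z with hP
  have hcomb : (fun s : ℝ => ∑ a ∈ T, s ^ a * (Q a + P (a - 1)))
      =o[𝓝[>] (0 : ℝ)] (fun s : ℝ => s) := by
    have hB' := (isBigO_refl (fun s : ℝ => s) (𝓝[>] (0 : ℝ))).mul_isLittleO hB
    simp only [pow_zero, mul_one] at hB'
    simp only [pow_one] at hA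
    refine (hA.add hB').neg_left.congr' ?_ EventuallyEq.rfl
    filter_upwards [hev] with s hs
    rw [hibp s hs, Finset.sum_image (by intro a _ b _ h; simpa using h)]
    have : ∀ a ∈ T, s ^ a * (Q a + P (a - 1)) = s ^ a * Q a + s * (s ^ (a - 1) * P (a - 1)) := by
      intro a _
      have : s ^ a = s * s ^ (a - 1) := by
        rw [Real.rpow_sub_one hs.1.ne']; field_simp [hs.1.ne']
      rw [mul_add, ← mul_assoc s, ← this]
    rw [Finset.sum_congr rfl this, Finset.sum_add_distrib, ← Finset.mul_sum]
    simp only [hQ, hP]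
    ring
  have hfin := aux_unique (fun a => Q a + P (a - 1)) T hT1 hcomb 1 (by simp [T])
  simp only [sub_self] at hfin
  set M : ℝ := ∫ t in Set.Ioi (0 : ℝ), t ^ 2 * (t ^ (0 : ℝ) * ψ (t ^ 2)) with hM
  have hP0 : P 0 = M * ∫ n : S2, c' 0 n ∂dOmega := by
    have := aux_polar (fun t => t ^ (0 : ℝ) * ψ (t ^ 2)) (g' 0)
    simp only [hgc'] at this
    rw [hM, ← this]
    simp only [hP, Φ]
    congr 1; funext z; ring
  have hQ1 : Q 1 = -3 * M * ∫ n : S2, (n : E3) i * c 1 n ∂dOmega := by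
    have := aux_polar (fun t => t ^ (1 : ℝ) * (2 * t * deriv ψ (t ^ 2))) (fun z => z i * g 1 z)
    simp only [hgc] at this
    rw [hM, ← aux_oned hψ (fun t ht => hψ0 t fun h => by linarith [h.2]), ← this]
    simp only [hQ, hKe]
    congr 1; funext z
    by_cases hz : z = 0
    · simp [hz]
    · have : ‖z‖ ≠ 0 := norm_ne_zero_iff.2 hz
      simp only [PiLp.smul_apply, smul_eq_mul]
      field_simp
  have hM0 : M ≠ 0 := by
    have h1 := aux_polar (fun t => t ^ (0 : ℝ) * ψ (t ^ 2)) (fun _ => 1)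
    have hcs : HasCompactSupport Φ := HasCompactSupport.intro isCompact_Ann hΦ0
    have h2 : 0 < ∫ z, Φ z := by
      refine hΦ.continuous.integral_pos_of_hasCompactSupport_nonneg_nonzero hcs
        (fun z => ψ.nonneg) (x := EuclideanSpace.single i (Real.sqrt (5 / 2))) ?_
      have : ‖(EuclideanSpace.single i (Real.sqrt (5 / 2)) : E3)‖ ^ 2 = 5 / 2 := by
        rw [EuclideanSpace.norm_single, Real.norm_eq_abs, sq_abs, Real.sq_sqrt (by norm_num)]
      simp only [Φ, this]
      rw [ψ.one_of_mem_closedBall (Metric.mem_closedBall_self ψ.rIn_pos.le)]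
      exact one_ne_zero
    intro h
    rw [← hM, h, zero_mul] at h1
    simp only [Real.rpow_zero, one_mul, mul_one] at h1
    exact h2.ne' h1
  rw [hP0, hQ1] at hfin
  have : M * ((∫ n : S2, c' 0 n ∂dOmega) - 3 * ∫ n : S2, (n : E3) i * c 1 n ∂dOmega) = 0 := by
    linarith
  rcases mul_eq_zero.1 this with h | h
  · exact absurd h hM0
  · linarith

lemma aux_coeff
    (y : E3) (F : E3 → ℝ) (c : ℝ → S2 → ℝ) (hFc : HasSingExpansion y F c) (i : Fin 3)
    (p : ℝ → S2 → ℝ)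
    (hp : HasSingExpansion y (fun x => (x - y) i / ‖x - y‖ ^ 2 * F x) p) (n : S2) :
    p 0 n = (n : E3) i * c 1 n := by
  let T : Finset ℝ := (hFc.finite_exponents 1).toFinset ∪
    ((hp.finite_exponents 0).toFinset.image (fun a => a + 1) ∪ {1})
  have hT1 : ∀ a ∈ T, a ≤ 1 := by
    intro a ha
    simp only [T, Finset.mem_union, Finset.mem_image, Set.Finite.mem_toFinset, Set.mem_ofPred_eq,
      Finset.mem_singleton] at ha
    rcases ha with h | ⟨b, hb, rfl⟩ | h
    · exact h.1
    · linarith [hb.1]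
    · exact h.le
  let T' : Finset ℝ := T.image (fun a => a - 1)
  have hA : (fun s : ℝ => F (y + s • (n : E3)) - ∑ a ∈ T, s ^ a * c a n)
      =o[𝓝[>] (0 : ℝ)] (fun s : ℝ => s) := by
    rw [isLittleO_iff]
    intro ε hε
    obtain ⟨δ, hδ, h⟩ := hFc.expansion 1 ε hε
    filter_upwards [Ioo_mem_nhdsGT hδ] with s hs
    have := h s hs.1 hs.2 n
    rw [aux_finsum c _ T (by simpa using hT1)] at this
    · simpa [abs_of_pos hs.1] using this
    · intro a ha hca
      simp only [T, Finset.mem_union, Set.Finite.mem_toFinset, Set.mem_ofPred_eq]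
      exact Or.inl ⟨by simpa using ha, hca⟩
  have hB : (fun s : ℝ => (n : E3) i / s * F (y + s • (n : E3)) - ∑ a ∈ T', s ^ a * p a n)
      =o[𝓝[>] (0 : ℝ)] (fun _ : ℝ => (1 : ℝ)) := by
    rw [isLittleO_iff]
    intro ε hε
    obtain ⟨δ, hδ, h⟩ := hp.expansion 0 ε hε
    filter_upwards [Ioo_mem_nhdsGT hδ] with s hs
    have := h s hs.1 hs.2 n
    rw [aux_finsum p _ T'] at this
    · have hn : ‖(n : E3)‖ = 1 := by simpa using n.2
      have he : (y + s • (n : E3) - y) i / ‖y + s • (n : E3) - y‖ ^ 2 = (n : E3) i / s := by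
        rw [add_sub_cancel_left, norm_smul, hn, mul_one, Real.norm_eq_abs, sq_abs]
        simp only [PiLp.smul_apply, smul_eq_mul]
        have := hs.1.ne'
        field_simp
      rw [he] at this
      simpa using this
    · intro a ha
      obtain ⟨b, hb, rfl⟩ := Finset.mem_image.1 ha
      have := hT1 b hb
      push_cast; linarith
    · intro a ha hca
      refine Finset.mem_image.2 ⟨a + 1, ?_, by ring⟩
      simp only [T, Finset.mem_union]
      refine Or.inr (Or.inl (Finset.mem_image.2 ⟨a, ?_, rfl⟩))
      rw [Set.Finite.mem_toFinset]
      exact ⟨by simpa using ha, hca⟩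
  have hcomb : (fun s : ℝ => ∑ a ∈ T, s ^ a * (p (a - 1) n - (n : E3) i * c a n))
      =o[𝓝[>] (0 : ℝ)] (fun s : ℝ => s) := by
    have hB' := (isBigO_refl (fun s : ℝ => s) (𝓝[>] (0 : ℝ))).mul_isLittleO hB
    simp only [mul_one] at hB'
    refine ((hA.const_mul_left ((n : E3) i)).sub hB').congr' ?_ EventuallyEq.rfl
    filter_upwards [self_mem_nhdsWithin] with s hs
    have hs : 0 < s := hs
    rw [Finset.sum_image (by intro a _ b _ h; simpa using h)]
    have : ∀ a ∈ T, s ^ a * (p (a - 1) n - (n : E3) i * c a n)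
        = s * (s ^ (a - 1) * p (a - 1) n) - (n : E3) i * (s ^ a * c a n) := by
      intro a _
      have : s ^ a = s * s ^ (a - 1) := by
        rw [Real.rpow_sub_one hs.ne']; field_simp [hs.ne']
      rw [mul_sub, ← mul_assoc s, ← this]; ring
    rw [Finset.sum_congr rfl this, Finset.sum_sub_distrib, ← Finset.mul_sum, ← Finset.mul_sum]
    have h2 : s * ((n : E3) i / s * F (y + s • (n : E3))) = (n : E3) i * F (y + s • (n : E3)) := by
      field_simp
    rw [mul_sub, mul_sub, h2]
    ring
  have := aux_unique (fun a => p (a - 1) n - (n : E3) i * c a n) T hT1 hcomb 1 (by simp [T])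
  simp only [sub_self] at this
  linarith

/-- partie finie of a gradient at the singular point:
`(∂_iF)_y = 3 (nⁱ r⁻¹ F)_y = (3/4π) ∫_{S²} nⁱ f₁ dΩ`. -/
theorem pf_of_gradient_at_singularity
    (y : E3) (F : E3 → ℝ) (c : ℝ → S2 → ℝ)
    (hF : SmoothNearPunctured y F) (hFc : HasSingExpansion y F c)
    (i : Fin 3) (c' : ℝ → S2 → ℝ)
    (hc' : HasSingExpansion y (pder i F) c') :
    pfAt c' = 3 * ((4 * π)⁻¹ * ∫ n : S2, (n : E3) i * c 1 n ∂dOmega)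
      ∧ ∀ p : ℝ → S2 → ℝ,
          HasSingExpansion y (fun x => (x - y) i / ‖x - y‖ ^ 2 * F x) p →
          pfAt c' = 3 * pfAt p := by
  have h := aux_main y F c hF hFc i c' hc'
  have h1 : pfAt c' = 3 * ((4 * π)⁻¹ * ∫ n : S2, (n : E3) i * c 1 n ∂dOmega) := by
    rw [pfAt, h]; ring
  refine ⟨h1, fun p hp => ?_⟩
  rw [h1, pfAt]
  simp only [aux_coeff y F c hFc i p hp]

end
end

section
/- Let F be smooth on a punctured neighbourhood of y ∈ ℝ³ and assume that both F and its partial derivative ∂_iF admit singular expansions at y. Then the Hadamard partie finie at y of the function x ↦ r³ ∂_iF(x) vanishes: (r³ ∂_iF)_y = 0. -/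
open MeasureTheory Filter Topology Real Asymptotics

noncomputable section

/-- The closed annulus `1 ≤ |z| ≤ 2`. -/
def annulus : Set E3 := {z | 1 ≤ ‖z‖ ∧ ‖z‖ ≤ 2}

lemma isCompact_annulus : IsCompact annulus := by
  refine (isCompact_closedBall (0 : E3) 2).of_isClosed_subset ?_ ?_
  · exact (isClosed_le continuous_const continuous_norm).inter
      (isClosed_le continuous_norm continuous_const)
  · intro z hz
    simpa using hz.2

lemma annulus_ne_zero {z : E3} (hz : z ∈ annulus) : ‖z‖ ≠ 0 := by
  have := hz.1
  intro h
  linarith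

lemma coeff_zero (T : Finset ℝ) (α : ℝ → ℝ)
    (h : Tendsto (fun s : ℝ => ∑ a ∈ T, s ^ a * α a) (𝓝[>] 0) (𝓝 0)) :
    ∀ a ∈ T, a ≤ 0 → α a = 0 := by
  induction T using Finset.induction_on_min with
  | empty => simp
  | insert m T hm ih =>
    have hmT : m ∉ T := fun h' => lt_irrefl _ (hm m h')
    have key : m ≤ 0 → α m = 0 := by
      intro hm0
      have h1 : Tendsto (fun s : ℝ => s ^ (-m) * ∑ a ∈ insert m T, s ^ a * α a)
          (𝓝[>] 0) (𝓝 ((0 : ℝ) ^ (-m) * 0)) := by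
        refine Tendsto.mul ?_ h
        exact ((Real.continuousAt_rpow_const 0 (-m) (Or.inr (by linarith))).tendsto).mono_left
          nhdsWithin_le_nhds
      have h2 : Tendsto (fun s : ℝ => α m + ∑ a ∈ T, s ^ (a - m) * α a)
          (𝓝[>] 0) (𝓝 (α m + ∑ a ∈ T, 0 * α a)) := by
        refine tendsto_const_nhds.add (tendsto_finsetSum _ fun a ha => ?_)
        refine Tendsto.mul_const _ ?_
        have hpos : 0 < a - m := by linarith [hm a ha]
        have := ((Real.continuousAt_rpow_const 0 (a - m) (Or.inr hpos.le)).tendsto).mono_left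
          (nhdsWithin_le_nhds (s := Set.Ioi (0 : ℝ)))
        rwa [Real.zero_rpow hpos.ne'] at this
      have h3 : (fun s : ℝ => s ^ (-m) * ∑ a ∈ insert m T, s ^ a * α a) =ᶠ[𝓝[>] 0]
          (fun s : ℝ => α m + ∑ a ∈ T, s ^ (a - m) * α a) := by
        filter_upwards [self_mem_nhdsWithin] with s hs
        have hs : 0 < s := hs
        rw [Finset.sum_insert hmT, mul_add, Finset.mul_sum, ← mul_assoc, ← Real.rpow_add hs]
        simp only [neg_add_cancel, Real.rpow_zero, one_mul]
        congr 1
        refine Finset.sum_congr rfl fun a _ => ?_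
        rw [← mul_assoc, ← Real.rpow_add hs]
        congr 2
        ring
      have := tendsto_nhds_unique (h1.congr' h3) h2
      simpa using this.symm
    by_cases hm0 : m ≤ 0
    · have hz := key hm0
      have h' : Tendsto (fun s : ℝ => ∑ a ∈ T, s ^ a * α a) (𝓝[>] 0) (𝓝 0) := by
        refine h.congr fun s => ?_
        rw [Finset.sum_insert hmT, hz]
        simp
      intro a ha ha0
      rcases Finset.mem_insert.1 ha with rfl | ha
      · exact hz
      · exact ih h' a ha ha0
    · intro a ha ha0
      rcases Finset.mem_insert.1 ha with rfl | ha
      · exact absurd ha0 hm0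
      · exact absurd ha0 (by linarith [hm a ha])

lemma polar (k : ℝ → ℝ) (g : E3 → ℝ) :
    ∫ z : E3, k ‖z‖ * g (‖z‖⁻¹ • z) =
      (∫ n : S2, g n ∂dOmega) * ∫ r in Set.Ioi (0 : ℝ), r ^ 2 * k r := by
  have hd : Module.finrank ℝ E3 - 1 = 2 := by simp
  calc ∫ z : E3, k ‖z‖ * g (‖z‖⁻¹ • z)
      = ∫ x : ({(0)}ᶜ : Set E3), k ‖x.1‖ * g (‖x.1‖⁻¹ • x.1)
          ∂((volume : Measure E3).comap (↑)) := by
        rw [integral_subtype_comap (measurableSet_singleton _).compl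
          fun x : E3 ↦ k ‖x‖ * g (‖x‖⁻¹ • x), restrict_compl_singleton]
    _ = ∫ x : S2 × Set.Ioi (0 : ℝ), g x.1 * k x.2
          ∂(volume : Measure E3).toSphere.prod (.volumeIoiPow (Module.finrank ℝ E3 - 1)) := by
        rw [← ((volume : Measure E3).measurePreserving_homeomorphUnitSphereProd).integral_comp
          (Homeomorph.measurableEmbedding _)]
        refine integral_congr_ae (Eventually.of_forall fun x => ?_)
        simp [mul_comm]
    _ = _ := by
        rw [integral_prod_mul (fun n : S2 => g n) (fun r : Set.Ioi (0 : ℝ) => k r), hd]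
        congr 1
        simp only [Measure.volumeIoiPow, ENNReal.ofReal]
        rw [integral_withDensity_eq_integral_smul,
          integral_subtype_comap measurableSet_Ioi fun a ↦ Real.toNNReal (a ^ 2) • k a,
          setIntegral_congr_fun measurableSet_Ioi fun x hx ↦ ?_]
        · rw [NNReal.smul_def, Real.coe_toNNReal _ (pow_nonneg hx.out.le _), smul_eq_mul]
        · exact (measurable_subtype_coe.pow_const _).real_toNNReal

lemma asym {y : E3} {H : E3 → ℝ} {p : ℝ → S2 → ℝ} (h : HasSingExpansion y H p)
    (hcont : ∀ᶠ s : ℝ in 𝓝[>] 0, ContinuousOn (fun z : E3 => H (y + s • z)) annulus)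
    (w : E3 → ℝ) (hw : ContinuousOn w annulus)
    (g : ℝ → E3 → ℝ) (hg : ∀ a, Continuous (g a)) (hgp : ∀ a (n : S2), g a n = p a n)
    (T : Finset ℝ) (hT : ∀ a, a ∈ T ↔ a ≤ 0 ∧ p a ≠ 0) :
    Tendsto (fun s : ℝ => (∫ z in annulus, w z * H (y + s • z)) -
      ∑ a ∈ T, s ^ a * ∫ z in annulus, w z * (‖z‖ ^ a * g a (‖z‖⁻¹ • z)))
      (𝓝[>] 0) (𝓝 0) := by
  have hterm : ∀ a, ContinuousOn (fun z : E3 => w z * (‖z‖ ^ a * g a (‖z‖⁻¹ • z))) annulus := by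
    intro a
    refine hw.mul (ContinuousOn.mul ?_ ?_)
    · exact ContinuousOn.rpow_const continuous_norm.continuousOn
        fun z hz => Or.inl (annulus_ne_zero hz)
    · refine (hg a).comp_continuousOn ?_
      exact (continuous_norm.continuousOn.inv₀ fun z hz => annulus_ne_zero hz).smul continuousOn_id
  obtain ⟨M, hM⟩ := isCompact_annulus.exists_bound_of_continuousOn hw
  set V : ℝ := (volume : Measure E3).real annulus with hV
  have hV0 : 0 ≤ V := measureReal_nonneg
  have hfin : (volume : Measure E3) annulus < ⊤ := isCompact_annulus.measure_lt_top
  rw [Metric.tendsto_nhds]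
  intro ε hε
  set K : ℝ := (|M| + 1) * (V + 1) with hK
  have hK0 : 0 < K := by positivity
  obtain ⟨δ, hδ, hexp⟩ := h.expansion 0 (ε / (2 * K)) (by positivity)
  filter_upwards [hcont, self_mem_nhdsWithin,
    nhdsWithin_le_nhds (Iio_mem_nhds (show (0 : ℝ) < δ / 2 by positivity))] with s hs hs0 hsδ
  have hs0 : 0 < s := hs0
  have hsδ : s < δ / 2 := hsδ
  have hI : (∫ z in annulus, w z * H (y + s • z)) -
      ∑ a ∈ T, s ^ a * ∫ z in annulus, w z * (‖z‖ ^ a * g a (‖z‖⁻¹ • z)) =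
      ∫ z in annulus, (w z * H (y + s • z) -
        ∑ a ∈ T, s ^ a * (w z * (‖z‖ ^ a * g a (‖z‖⁻¹ • z)))) := by
    rw [integral_sub, integral_finsetSum]
    · simp_rw [integral_const_mul]
    · intro a _
      exact ((hterm a).integrableOn_compact isCompact_annulus).const_mul _
    · exact (hw.mul hs).integrableOn_compact isCompact_annulus
    · refine integrable_finsetSum _ fun a _ => ?_
      exact ((hterm a).integrableOn_compact isCompact_annulus).const_mul _
  rw [hI, dist_zero_right]
  have hb : ∀ z ∈ annulus, ‖w z * H (y + s • z) -
        ∑ a ∈ T, s ^ a * (w z * (‖z‖ ^ a * g a (‖z‖⁻¹ • z)))‖ ≤ |M| * (ε / (2 * K)) := by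
    intro z hz
    have hz0 := annulus_ne_zero hz
    have hzp : 0 < ‖z‖ := by linarith [hz.1]
    let n : S2 := ⟨‖z‖⁻¹ • z, by simp [norm_smul, hz0]⟩
    have he := hexp (s * ‖z‖) (by positivity) (by nlinarith [hz.2]) n
    have hn : (s * ‖z‖) • (n : E3) = s • z := by
      simp only [n, smul_smul]
      rw [mul_assoc, mul_inv_cancel₀ hz0, mul_one]
    rw [hn] at he
    have hsum : ∑ᶠ (a : ℝ) (_ : a ≤ ((0 : ℕ) : ℝ)), (s * ‖z‖) ^ a * p a n =
        ∑ a ∈ T, (s * ‖z‖) ^ a * p a n := by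
      refine finsum_cond_eq_sum_of_cond_iff _ ?_
      intro a ha
      rw [hT]
      have : p a ≠ 0 := by
        intro h0
        apply ha
        simp [h0]
      simp [this]
    rw [hsum] at he
    have : w z * H (y + s • z) - ∑ a ∈ T, s ^ a * (w z * (‖z‖ ^ a * g a (‖z‖⁻¹ • z))) =
        w z * (H (y + s • z) - ∑ a ∈ T, (s * ‖z‖) ^ a * p a n) := by
      rw [mul_sub, Finset.mul_sum]
      congr 1
      refine Finset.sum_congr rfl fun a _ => ?_
      rw [← hgp a n, Real.mul_rpow hs0.le hzp.le]
      ring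
    rw [this, norm_mul]
    refine mul_le_mul ((hM z hz).trans (le_abs_self M)) ?_ (norm_nonneg _) (abs_nonneg _)
    simpa using he
  have := norm_setIntegral_le_of_norm_le_const hfin hb
  refine this.trans_lt ?_
  have h1 : |M| * (ε / (2 * K)) * V ≤ ε / 2 := by
    have : |M| * V ≤ K := by
      rw [hK]; nlinarith [abs_nonneg M]
    calc |M| * (ε / (2 * K)) * V = (|M| * V) * (ε / (2 * K)) := by ring
      _ ≤ K * (ε / (2 * K)) := by gcongr
      _ = ε / 2 := by field_simp
  change |M| * (ε / (2 * K)) * V < ε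
  linarith

/-- A bump function in the variable `|z|²`. -/
def bmp : ContDiffBump (2 : ℝ) := ⟨1 / 2, 1, by norm_num, by norm_num⟩

lemma bmp_zero {t : ℝ} (ht : t ≤ 1 ∨ 3 ≤ t) : bmp t = 0 := by
  apply bmp.zero_of_le_dist
  change (1 : ℝ) ≤ |t - 2|
  rcases ht with ht | ht
  · rw [abs_of_nonpos] <;> linarith
  · rw [abs_of_nonneg] <;> linarith

lemma bmp_diff : Differentiable ℝ bmp :=
  (bmp.contDiff (n := 1)).differentiable (by norm_num)

lemma deriv_bmp_cont : Continuous (deriv bmp) :=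
  (bmp.contDiff (n := 1)).continuous_deriv (by norm_num)

lemma deriv_bmp_zero {t : ℝ} (ht : t < 1 ∨ 3 < t) : deriv bmp t = 0 := by
  have : (bmp : ℝ → ℝ) =ᶠ[𝓝 t] fun _ => 0 := by
    rcases ht with ht | ht
    · filter_upwards [Iio_mem_nhds ht] with x hx
      exact bmp_zero (Or.inl (le_of_lt hx))
    · filter_upwards [Ioi_mem_nhds ht] with x hx
      exact bmp_zero (Or.inr (le_of_lt hx))
  rw [this.deriv_eq]
  simp

lemma not_annulus {z : E3} (hz : z ∉ annulus) : ‖z‖ ^ 2 < 1 ∨ 3 < ‖z‖ ^ 2 := by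
  by_contra hcon
  push Not at hcon
  apply hz
  constructor
  · nlinarith [norm_nonneg z]
  · nlinarith [norm_nonneg z]

lemma hasFDerivAt_chi (z : E3) : HasFDerivAt (fun z : E3 => bmp (‖z‖ ^ 2))
    (deriv bmp (‖z‖ ^ 2) • ((2 : ℝ) • innerSL ℝ z)) z := by
  have h1 : HasFDerivAt (fun z : E3 => ‖z‖ ^ 2) ((2 : ℝ) • innerSL ℝ z) z := by
    have := (hasStrictFDerivAt_norm_sq z).hasFDerivAt
    have e : (2 : ℝ) • innerSL ℝ z = 2 • innerSL ℝ z := by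
      refine ContinuousLinearMap.ext fun v => ?_
      simp
    rw [e]
    exact this
  exact (bmp_diff _).hasDerivAt.comp_hasFDerivAt z h1

lemma tsupport_chi : tsupport (fun z : E3 => bmp (‖z‖ ^ 2)) ⊆ annulus := by
  refine closure_minimal ?_ isCompact_annulus.isClosed
  intro z hz
  by_contra hz'
  apply hz
  apply bmp_zero
  rcases not_annulus hz' with h | h
  · exact Or.inl h.le
  · exact Or.inr h.le

/-- weight for the gradient term -/
def w₁ (z : E3) : ℝ := bmp (‖z‖ ^ 2) * (‖z‖ ^ 3)⁻¹

/-- weight for the function term -/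
def w₂ (i : Fin 3) (z : E3) : ℝ := deriv bmp (‖z‖ ^ 2) * (2 * z i)

lemma w₁_cont : ContinuousOn w₁ annulus := by
  refine ContinuousOn.mul ?_ ?_
  · exact (bmp.continuous.comp (continuous_norm.pow 2)).continuousOn
  · exact (continuous_norm.pow 3).continuousOn.inv₀ fun z hz => pow_ne_zero _ (annulus_ne_zero hz)

lemma w₂_cont (i : Fin 3) : Continuous (w₂ i) := by
  refine (deriv_bmp_cont.comp (continuous_norm.pow 2)).mul (continuous_const.mul ?_)
  fun_prop

lemma w₁_zero {z : E3} (hz : z ∉ annulus) : w₁ z = 0 := by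
  have : bmp (‖z‖ ^ 2) = 0 := bmp_zero ((not_annulus hz).imp le_of_lt le_of_lt)
  simp [w₁, this]

lemma w₂_zero (i : Fin 3) {z : E3} (hz : z ∉ annulus) : w₂ i z = 0 := by
  simp [w₂, deriv_bmp_zero (not_annulus hz)]

lemma measurableSet_annulus : MeasurableSet annulus := isCompact_annulus.isClosed.measurableSet

lemma integrable_of_annulus {f : E3 → ℝ} (hf : ContinuousOn f annulus)
    (h0 : ∀ z, z ∉ annulus → f z = 0) : Integrable f :=
  (integrableOn_iff_integrable_of_support_subset (fun z hz => by
    by_contra h; exact hz (h0 z h))).1 (hf.integrableOn_compact isCompact_annulus)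

lemma parts {y : E3} {F : E3 → ℝ} (i : Fin 3) {s : ℝ} (hs : 0 < s)
    (hd : ∀ z ∈ annulus, ContDiffAt ℝ 1 F (y + s • z)) :
    (∫ z in annulus, w₁ z * (‖(y + s • z) - y‖ ^ 3 * pder i F (y + s • z))) =
      - s ^ 2 * ∫ z in annulus, w₂ i z * F (y + s • z) := by
  have hmap : Continuous (fun z : E3 => y + s • z) := by fun_prop
  have hcF : ContinuousOn (fun z : E3 => F (y + s • z)) annulus := fun z hz =>
    ((hd z hz).continuousAt.comp (f := fun z : E3 => y + s • z)
      hmap.continuousAt).continuousWithinAt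
  have hcG : ContinuousOn (fun z : E3 => fderiv ℝ F (y + s • z)) annulus := fun z hz =>
    (((hd z hz).fderiv_right (m := 0) (by norm_num)).continuousAt.comp
      (f := fun z : E3 => y + s • z) hmap.continuousAt).continuousWithinAt
  have hcp : ContinuousOn (fun z : E3 => pder i F (y + s • z)) annulus :=
    hcG.clm_apply continuousOn_const
  have hchi : Continuous (fun z : E3 => bmp (‖z‖ ^ 2)) :=
    bmp.continuous.comp (continuous_norm.pow 2)
  have hchi0 : ∀ z : E3, z ∉ annulus → bmp (‖z‖ ^ 2) = 0 := fun z hz =>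
    bmp_zero ((not_annulus hz).imp le_of_lt le_of_lt)
  have hw : ∀ z : E3, (deriv bmp (‖z‖ ^ 2) • ((2 : ℝ) • innerSL ℝ z))
      (EuclideanSpace.single i (1 : ℝ)) = w₂ i z := by
    intro z
    simp [w₂, EuclideanSpace.inner_single_right]
  have key := integral_bilinear_hasFDerivAt_right_eq_neg_left_of_integrable
    (μ := (volume : Measure E3)) (B := ContinuousLinearMap.mul ℝ ℝ)
    (f := fun z : E3 => bmp (‖z‖ ^ 2))
    (f' := fun z => deriv bmp (‖z‖ ^ 2) • ((2 : ℝ) • innerSL ℝ z))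
    (g := fun z => F (y + s • z)) (g' := fun z => s • fderiv ℝ F (y + s • z))
    (v := EuclideanSpace.single i (1 : ℝ)) ?_ ?_ ?_ (fun z _ => hasFDerivAt_chi z) ?_
  · simp only [hw, ContinuousLinearMap.mul_apply', _root_.smul_apply,
      smul_eq_mul] at key
    have e1 : (∫ z in annulus, w₁ z * (‖(y + s • z) - y‖ ^ 3 * pder i F (y + s • z))) =
        s ^ 2 * ∫ z : E3, bmp (‖z‖ ^ 2) *
          (s * fderiv ℝ F (y + s • z) (EuclideanSpace.single i 1)) := by
      have e0 : (∫ z in annulus, bmp (‖z‖ ^ 2) *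
          (s * fderiv ℝ F (y + s • z) (EuclideanSpace.single i 1))) = ∫ z : E3, bmp (‖z‖ ^ 2) *
          (s * fderiv ℝ F (y + s • z) (EuclideanSpace.single i 1)) :=
        setIntegral_eq_integral_of_forall_compl_eq_zero fun z hz => by simp [hchi0 z hz]
      rw [← e0, ← integral_const_mul]
      · refine setIntegral_congr_fun measurableSet_annulus fun z hz => ?_
        have := annulus_ne_zero hz
        simp only [w₁, pder, add_sub_cancel_left, norm_smul, Real.norm_eq_abs, abs_of_pos hs]
        field_simp
    rw [e1, key, ← setIntegral_eq_integral_of_forall_compl_eq_zero (s := annulus)]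
    · ring
    · intro z hz
      simp [w₂_zero i hz]
  · simp only [hw, ContinuousLinearMap.mul_apply']
    exact integrable_of_annulus ((w₂_cont i).continuousOn.mul hcF)
      fun z hz => by simp [w₂_zero i hz]
  · simp only [ContinuousLinearMap.mul_apply', _root_.smul_apply, smul_eq_mul]
    exact integrable_of_annulus (hchi.continuousOn.mul (continuousOn_const.mul hcp))
      fun z hz => by simp [hchi0 z hz]
  · simp only [ContinuousLinearMap.mul_apply']
    exact integrable_of_annulus (hchi.continuousOn.mul hcF)
      fun z hz => by simp [hchi0 z hz]
  · intro z hz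
    have hz := tsupport_chi hz
    have h1 : HasFDerivAt (fun z : E3 => y + s • z) (s • ContinuousLinearMap.id ℝ E3) z :=
      ((hasFDerivAt_id z).const_smul s).const_add y
    have h2 := ((hd z hz).differentiableAt (by norm_num)).hasFDerivAt.comp z h1
    have e : s • fderiv ℝ F (y + s • z) =
        (fderiv ℝ F (y + s • z)).comp (s • ContinuousLinearMap.id ℝ E3) := by
      refine ContinuousLinearMap.ext fun v => ?_
      simp
    rw [e]
    exact h2

lemma smooth_scaled {y : E3} {F : E3 → ℝ} (hF : SmoothNearPunctured y F) :
    ∀ᶠ s : ℝ in 𝓝[>] 0, ∀ z ∈ annulus, ContDiffAt ℝ 1 F (y + s • z) := by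
  obtain ⟨U, hU, hFU⟩ := hF
  obtain ⟨δ, hδ, hball⟩ := Metric.mem_nhds_iff.1 hU
  filter_upwards [self_mem_nhdsWithin,
    nhdsWithin_le_nhds (Iio_mem_nhds (show (0 : ℝ) < δ / 2 by positivity))] with s hs0 hsδ z hz
  have hs0 : 0 < s := hs0
  have hsδ : s < δ / 2 := hsδ
  have hz0 := annulus_ne_zero hz
  have hopen : IsOpen (Metric.ball y δ \ {y}) :=
    Metric.isOpen_ball.sdiff isClosed_singleton
  have hmem : y + s • z ∈ Metric.ball y δ \ {y} := by
    constructor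
    · simp only [Metric.mem_ball, dist_self_add_left, norm_smul, Real.norm_eq_abs, abs_of_pos hs0]
      nlinarith [hz.2]
    · simpa [hs0.ne'] using hz0
  have hmono : Metric.ball y δ \ {y} ⊆ U \ {y} := Set.sdiff_subset_sdiff_left hball
  exact ((hFU.mono hmono).contDiffAt (hopen.mem_nhds hmem)).of_le (by exact_mod_cast le_top)

lemma radial₁_pos : 0 < ∫ r in Set.Ioi (0 : ℝ), r ^ 2 * (bmp (r ^ 2) * (r ^ 3)⁻¹) := by
  have hcont : ContinuousOn (fun r : ℝ => r ^ 2 * (bmp (r ^ 2) * (r ^ 3)⁻¹)) (Set.Icc 1 2) := by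
    refine (continuous_pow 2).continuousOn.mul (ContinuousOn.mul ?_ ?_)
    · exact (bmp.continuous.comp (continuous_pow 2)).continuousOn
    · exact (continuous_pow 3).continuousOn.inv₀ fun r hr =>
        pow_ne_zero _ (by linarith [hr.1])
  have heq : ∫ r in Set.Ioi (0 : ℝ), r ^ 2 * (bmp (r ^ 2) * (r ^ 3)⁻¹) =
      ∫ r in (1 : ℝ)..2, r ^ 2 * (bmp (r ^ 2) * (r ^ 3)⁻¹) := by
    rw [intervalIntegral.integral_of_le (by norm_num)]
    refine setIntegral_eq_of_subset_of_forall_sdiff_eq_zero measurableSet_Ioi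
      (fun r hr => lt_trans one_pos hr.1) ?_
    rintro r ⟨hr, hr'⟩
    have hr : 0 < r := hr
    have : bmp (r ^ 2) = 0 := by
      apply bmp_zero
      by_contra hcon
      push Not at hcon
      apply hr'
      constructor <;> nlinarith
    simp [this]
  rw [heq]
  refine intervalIntegral.integral_pos (by norm_num) hcont ?_ ⟨1.4, by norm_num, ?_⟩
  · intro r hr
    have := bmp.nonneg' (r ^ 2)
    have : 0 < r := lt_trans one_pos hr.1
    positivity
  · have : 0 < bmp ((1.4 : ℝ) ^ 2) := by
      apply bmp.pos_of_mem_ball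
      rw [Metric.mem_ball]
      change |(1.4 : ℝ) ^ 2 - 2| < 1
      rw [abs_lt]
      norm_num
    positivity

lemma radial₂_zero : ∫ r in Set.Ioi (0 : ℝ), deriv bmp (r ^ 2) * (2 * r) = 0 := by
  have heq : ∫ r in Set.Ioi (0 : ℝ), deriv bmp (r ^ 2) * (2 * r) =
      ∫ r in (0 : ℝ)..2, deriv bmp (r ^ 2) * (2 * r) := by
    rw [intervalIntegral.integral_of_le (by norm_num)]
    refine setIntegral_eq_of_subset_of_forall_sdiff_eq_zero measurableSet_Ioi
      (fun r hr => hr.1) ?_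
    rintro r ⟨hr, hr'⟩
    have hr : 0 < r := hr
    have : deriv bmp (r ^ 2) = 0 := by
      apply deriv_bmp_zero
      by_contra hcon
      push Not at hcon
      apply hr'
      constructor <;> nlinarith
    simp [this]
  rw [heq, intervalIntegral.integral_eq_sub_of_hasDerivAt (f := fun r : ℝ => bmp (r ^ 2))]
  · rw [bmp_zero (by norm_num), bmp_zero (by norm_num), sub_zero]
  · intro r _
    have := (bmp_diff (r ^ 2)).hasDerivAt.comp r (hasDerivAt_pow 2 r)
    simp only [Nat.cast_ofNat, Nat.add_one_sub_one, pow_one] at this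
    exact this
  · refine Continuous.intervalIntegrable ?_ _ _
    exact (deriv_bmp_cont.comp (continuous_pow 2)).mul (by fun_prop)

theorem pf_r3_gradient_vanishes
    (y : E3) (F : E3 → ℝ) (c : ℝ → S2 → ℝ)
    (hF : SmoothNearPunctured y F) (hFc : HasSingExpansion y F c)
    (i : Fin 3) (c' : ℝ → S2 → ℝ)
    (hc' : HasSingExpansion y (pder i F) c') :
    ∀ p : ℝ → S2 → ℝ,
      HasSingExpansion y (fun x => ‖x - y‖ ^ 3 * pder i F x) p →
      pfAt p = 0 := by
  intro p hp
  choose P hPs hPp using hp.smooth_coeffs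
  choose C hCs hCc using hFc.smooth_coeffs
  set T₁ := (hp.finite_exponents 0).toFinset with hT₁
  set T₂ := (hFc.finite_exponents 0).toFinset with hT₂
  have hm₁ : ∀ a, a ∈ T₁ ↔ a ≤ 0 ∧ p a ≠ 0 := fun a => by simp [hT₁]
  have hm₂ : ∀ a, a ∈ T₂ ↔ a ≤ 0 ∧ c a ≠ 0 := fun a => by simp [hT₂]
  have hsm := smooth_scaled hF
  have hmap : ∀ s : ℝ, Continuous (fun z : E3 => y + s • z) := fun s => by fun_prop
  have hcF : ∀ᶠ s : ℝ in 𝓝[>] 0, ContinuousOn (fun z : E3 => F (y + s • z)) annulus := by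
    filter_upwards [hsm] with s hs z hz
    exact ((hs z hz).continuousAt.comp (f := fun z : E3 => y + s • z)
      (hmap s).continuousAt).continuousWithinAt
  have hcG : ∀ᶠ s : ℝ in 𝓝[>] 0, ContinuousOn
      (fun z : E3 => ‖(y + s • z) - y‖ ^ 3 * pder i F (y + s • z)) annulus := by
    filter_upwards [hsm] with s hs
    have h1 : ContinuousOn (fun z : E3 => fderiv ℝ F (y + s • z)) annulus := fun z hz =>
      (((hs z hz).fderiv_right (m := 0) (by norm_num)).continuousAt.comp
        (f := fun z : E3 => y + s • z) (hmap s).continuousAt).continuousWithinAt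
    refine ContinuousOn.mul ?_ (h1.clm_apply continuousOn_const)
    exact Continuous.continuousOn (by fun_prop)
  have as₁ := asym hp hcG w₁ w₁_cont P (fun a => (hPs a).continuous) hPp T₁ hm₁
  have as₂ := asym hFc hcF (w₂ i) (w₂_cont i).continuousOn C (fun a => (hCs a).continuous)
    hCc T₂ hm₂
  set A : ℝ → ℝ := fun a => ∫ z in annulus, w₁ z * (‖z‖ ^ a * P a (‖z‖⁻¹ • z)) with hA
  set B : ℝ → ℝ := fun a => ∫ z in annulus, w₂ i z * (‖z‖ ^ a * C a (‖z‖⁻¹ • z)) with hB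
  -- the two leading coefficients in polar coordinates
  have hA0 : A 0 = (∫ n : S2, p 0 n ∂dOmega) *
      ∫ r in Set.Ioi (0 : ℝ), r ^ 2 * (bmp (r ^ 2) * (r ^ 3)⁻¹) := by
    rw [← integral_congr_ae (Eventually.of_forall (hPp 0)), ← polar, hA]
    simp only
    rw [setIntegral_eq_integral_of_forall_compl_eq_zero]
    · refine integral_congr_ae (Eventually.of_forall fun z => ?_)
      simp [w₁]
    · intro z hz
      simp [w₁_zero hz]
  have hB0 : B (-2) = 0 := by
    have : B (-2) = ∫ z : E3, (deriv bmp (‖z‖ ^ 2) * (2 * ‖z‖) * (‖z‖ ^ 2)⁻¹) *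
        ((fun x : E3 => x i * C (-2) x) (‖z‖⁻¹ • z)) := by
      rw [hB]
      simp only
      rw [setIntegral_eq_integral_of_forall_compl_eq_zero]
      · refine integral_congr_ae (Eventually.of_forall fun z => ?_)
        by_cases hz : z = 0
        · simp [w₂, hz]
        · have hz' : ‖z‖ ≠ 0 := norm_ne_zero_iff.2 hz
          have h2 : ‖z‖ ^ (-2 : ℝ) = (‖z‖ ^ 2)⁻¹ := by
            rw [Real.rpow_neg (norm_nonneg z)]
            norm_num
          simp only [w₂, h2, PiLp.smul_apply, smul_eq_mul]
          field_simp
      · intro z hz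
        simp [w₂_zero i hz]
    rw [this, polar (fun r => deriv bmp (r ^ 2) * (2 * r) * (r ^ 2)⁻¹)
      (fun x : E3 => x i * C (-2) x)]
    have : ∫ r in Set.Ioi (0 : ℝ), r ^ 2 * (deriv bmp (r ^ 2) * (2 * r) * (r ^ 2)⁻¹) = 0 := by
      refine Eq.trans ?_ radial₂_zero
      refine setIntegral_congr_fun measurableSet_Ioi fun r hr => ?_
      have hr0 : 0 < r := hr
      have : r ≠ 0 := hr0.ne'
      field_simp
    rw [this, mul_zero]
  -- combine
  have hs2 : Tendsto (fun s : ℝ => s ^ 2) (𝓝[>] 0) (𝓝 0) := by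
    have : Tendsto (fun s : ℝ => s ^ 2) (𝓝 0) (𝓝 (0 ^ 2)) := (continuous_pow 2).tendsto 0
    simpa using this.mono_left nhdsWithin_le_nhds
  have hsum := (as₁.add (hs2.mul as₂)).neg
  classical
  set α : ℝ → ℝ := fun a => (if a ∈ T₁ then A a else 0) + (if a - 2 ∈ T₂ then B (a - 2) else 0)
    with hα
  set T := T₁ ∪ T₂.image (· + 2) with hT
  have hfinal : Tendsto (fun s : ℝ => ∑ a ∈ T, s ^ a * α a) (𝓝[>] 0) (𝓝 0) := by
    have h0 : -((0 : ℝ) + 0 * 0) = 0 := by norm_num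
    rw [h0] at hsum
    refine hsum.congr' ?_
    filter_upwards [hsm, self_mem_nhdsWithin] with s hs hs0
    have hs0 : 0 < s := hs0
    have hp' := parts i hs0 hs
    have e1 : ∑ a ∈ T, s ^ a * (if a ∈ T₁ then A a else 0) = ∑ a ∈ T₁, s ^ a * A a := by
      simp only [mul_ite, mul_zero]
      rw [← Finset.sum_filter]
      refine Finset.sum_congr ?_ fun _ _ => rfl
      ext a
      simp only [hT, Finset.mem_filter, Finset.mem_union]
      tauto
    have e2 : ∑ a ∈ T, s ^ a * (if a - 2 ∈ T₂ then B (a - 2) else 0) =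
        s ^ 2 * ∑ a ∈ T₂, s ^ a * B a := by
      simp only [mul_ite, mul_zero]
      rw [← Finset.sum_filter]
      have : T.filter (fun a => a - 2 ∈ T₂) = T₂.image (· + 2) := by
        ext a
        simp only [hT, Finset.mem_filter, Finset.mem_union, Finset.mem_image]
        constructor
        · rintro ⟨_, h⟩
          exact ⟨a - 2, h, by ring⟩
        · rintro ⟨b, hb, rfl⟩
          refine ⟨Or.inr ⟨b, hb, rfl⟩, ?_⟩
          simpa using hb
      rw [this, Finset.sum_image (fun a _ b _ h => by simpa using h), Finset.mul_sum]
      refine Finset.sum_congr rfl fun a _ => ?_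
      rw [Real.rpow_add hs0, add_sub_cancel_right, Real.rpow_two]
      ring
    have e3 : ∑ a ∈ T, s ^ a * α a = ∑ a ∈ T₁, s ^ a * A a + s ^ 2 * ∑ a ∈ T₂, s ^ a * B a := by
      rw [← e1, ← e2, ← Finset.sum_add_distrib]
      refine Finset.sum_congr rfl fun a _ => ?_
      rw [hα]
      ring
    rw [e3, hp']
    ring
  unfold pfAt
  by_cases h0 : (0 : ℝ) ∈ T₁
  · have := coeff_zero T α hfinal 0 (Finset.mem_union_left _ h0) le_rfl
    have hz : A 0 = 0 := by
      simpa [hα, h0, hB0] using this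
    rw [hA0] at hz
    rcases mul_eq_zero.1 hz with h | h
    · rw [h, mul_zero]
    · exact absurd h radial₁_pos.ne'
  · have : p 0 = 0 := by
      by_contra hne
      exact h0 ((hm₁ 0).2 ⟨le_rfl, hne⟩)
    simp [this]

end
end
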